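/- Let γ be a C¹, strictly convex, increasing function on (−∞,0] with 0 < γ'(ξ) < 1 for all ξ < 0, γ'(0) = 1 and γ(0) = 0. Let a_j := (γ')^{−1}(2^{−j}) for j ≥ 0 (so a_0 = 0 and (a_j) is strictly decreasing and negative for j ≥ 1), and set b_j := γ(a_j). Assume that the sequence (|a_j|)_{j≥0} is convex, i.e. |a_j| ≤ (|a_{j−1}| + |a_{j+1}|)/2 for all j ≥ 1. Then for every j ≥ 1 one has |b_j| ≤ 2|a_j − a_{j−1}|. -/

import Mathlib

open MeasureTheory Set
open scoped ENNReal NNReal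

noncomputable section

/-- The character `e^{2π i t x}`. -/
def eChar (t x : ℝ) : ℂ := Complex.exp (2 * Real.pi * Complex.I * t * x)

/-- The Fourier transform `f̂(ξ) = ∫ f(x) e^{-2π i ξ x} dx`. -/
def fourierT (f : ℝ → ℂ) (ξ : ℝ) : ℂ := ∫ x : ℝ, f x * eChar (-ξ) x

/-- The bilinear multiplier operator `B_m` with symbol `m`. -/
def Bm (m : ℝ → ℝ → ℂ) (f g : ℝ → ℂ) (x : ℝ) : ℂ :=
  ∫ ξ : ℝ, ∫ η : ℝ, m ξ η * fourierT f ξ * fourierT g η * eChar (ξ + η) x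

/-- Complex-valued indicator function of a set of reals. -/
def indC (s : Set ℝ) (x : ℝ) : ℂ := s.indicator 1 x

/-- The set `-A - B = {-x-y : x ∈ A, y ∈ B}`. -/
def mink2 (A B : Set ℝ) : Set ℝ := Set.image2 (fun x y => -x - y) A B

/-- The paraproduct symbol `m_{a,b}(ξ,η) = Σ_{j≥1} 1_{[a_{j+1},a_j)}(ξ) 1_{[b_j,b_0)}(η)`. -/
def mab (a b : ℕ → ℝ) (ξ η : ℝ) : ℂ :=
  ∑' j : ℕ, indC (Ico (a (j + 2)) (a (j + 1))) ξ * indC (Ico (b (j + 1)) (b 0)) η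

/-- The interval `-[a_{j+1},a_j) - [b_j, b_0)` from the collection `I_{a,b}`. -/
def Iab (a b : ℕ → ℝ) (j : ℕ) : Set ℝ := mink2 (Ico (a (j + 1)) (a j)) (Ico (b j) (b 0))

/-- The interval `-[a_{j+1},a_j) - (b_∞, b_j)` from the collection `J_{a,b}`. -/
def Jab (a b : ℕ → ℝ) (binf : ℝ) (j : ℕ) : Set ℝ :=
  mink2 (Ico (a (j + 1)) (a j)) (Ioo binf (b j))

/-- The symbol `m̃_{u,v}(ξ,η) = Σ_{j≥1} 1_{(u_0,u_j]}(ξ) 1_{[v_j,v_{j+1})}(η)`. -/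
def muv (u v : ℕ → ℝ) (ξ η : ℝ) : ℂ :=
  ∑' j : ℕ, indC (Ioc (u 0) (u (j + 1))) ξ * indC (Ico (v (j + 1)) (v (j + 2))) η

/-- The interval `-(u_0,u_j] - [v_j, v_{j+1})`. -/
def Iuv (u v : ℕ → ℝ) (j : ℕ) : Set ℝ :=
  mink2 (Ioc (u 0) (u j)) (Ico (v j) (v (j + 1)))

/-- The frequency projection `(1_S f̂)^∨`. -/
def fproj (S : Set ℝ) (f : ℝ → ℂ) (x : ℝ) : ℂ := ∫ ξ in S, fourierT f ξ * eChar ξ x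

/-- The `L^p(ℓ²)` norm of the family of frequency projections onto the sets `T i`. -/
def sqNormLp {ι : Type*} (T : ι → Set ℝ) (f : ℝ → ℂ) (p : ℝ) : ℝ≥0∞ :=
  (∫⁻ x : ℝ, (∑' i, ((‖fproj (T i) f x‖₊ : ℝ≥0∞)) ^ 2) ^ (p / 2)) ^ (1 / p)

/-- The collection of connected components of a set `U ⊆ ℝ`. -/
def componentsOf (U : Set ℝ) : Set (Set ℝ) := {S | ∃ x ∈ U, S = connectedComponentIn U x}

/-- A closed Lebesgue-null set `E ⊆ ℝ` is Littlewood–Paley if for every `1 < p < ∞` the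
square function associated with the connected components of `ℝ \ E` is comparable with the
`L^p` norm (stated on the dense class of Schwartz functions). -/
def IsLPSet (E : Set ℝ) : Prop :=
  IsClosed E ∧ volume E = 0 ∧
    ∀ p : ℝ, 1 < p → ∃ c : ℝ, 0 < c ∧ ∃ C : ℝ, 0 < C ∧
      ∀ f : SchwartzMap ℝ ℂ,
        ENNReal.ofReal c * eLpNorm (⇑f) (ENNReal.ofReal p) volume ≤
            sqNormLp (fun ω : componentsOf Eᶜ => (ω : Set ℝ)) (⇑f) p ∧
          sqNormLp (fun ω : componentsOf Eᶜ => (ω : Set ℝ)) (⇑f) p ≤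
            ENNReal.ofReal C * eLpNorm (⇑f) (ENNReal.ofReal p) volume

/-- A strictly monotone real sequence is Littlewood–Paley if the closure of its range is a
Littlewood–Paley set. -/
def IsLPSeq (a : ℕ → ℝ) : Prop := IsLPSet (closure (Set.range a))

/-- A family of (pairwise disjoint) intervals is Littlewood–Paley if for every `1 < p < ∞`
the associated square function is bounded by the `L^p` norm. -/
def IsLPFamily {ι : Type*} (T : ι → Set ℝ) : Prop :=
  ∀ p : ℝ, 1 < p → ∃ C : ℝ, 0 < C ∧ ∀ f : SchwartzMap ℝ ℂ,
    sqNormLp T (⇑f) p ≤ ENNReal.ofReal C * eLpNorm (⇑f) (ENNReal.ofReal p) volume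

/-- Slope of the `j`-th segment of the piecewise linear curve with vertices `(a_j, b_j)`. -/
def pslope (a b : ℕ → ℝ) (j : ℕ) : ℝ := (b j - b (j + 1)) / (a j - a (j + 1))

/-- The epigraph of the piecewise linear curve with vertices `(a_j, b_j)`. -/
def polyEpi (a b : ℕ → ℝ) : Set (ℝ × ℝ) :=
  ⋃ j : ℕ, {p : ℝ × ℝ | a (j + 1) ≤ p.1 ∧ p.1 ≤ a j ∧
    b (j + 1) + pslope a b j * (p.1 - a (j + 1)) ≤ p.2}

end

/-- Complex-valued indicator function of a set in the plane, as a bilinear symbol. -/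
noncomputable def indC2 (S : Set (ℝ × ℝ)) (ξ η : ℝ) : ℂ := S.indicator 1 (ξ, η)

/-- A convex function lies above its tangent lines. -/
theorem ConvexOn.tangent_le_of_hasDerivWithinAt {S : Set ℝ} {f : ℝ → ℝ} {f' x y : ℝ}
    (hf : ConvexOn ℝ S f) (hx : x ∈ S) (hy : y ∈ S) (hf' : HasDerivWithinAt f f' S x) :
    f x + f' * (y - x) ≤ f y := by
  rcases lt_trichotomy x y with h | rfl | h
  · have := hf.le_slope_of_hasDerivWithinAt hx hy h hf'
    rw [slope_def_field, le_div_iff₀ (sub_pos.2 h)] at this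
    linarith
  · simp
  · have := hf.slope_le_of_hasDerivWithinAt hy hx h hf'
    rw [slope_def_field, div_le_iff₀ (sub_pos.2 h)] at this
    linarith

/-- Key estimate for convex sequences: if `γ` is `C¹`, strictly convex and increasing on
`(-∞,0]` with `0 < γ' < 1` on `(-∞,0)`, `γ'(0) = 1`, `γ(0) = 0`, `a_j = (γ')⁻¹(2^{-j})`,
`b_j = γ(a_j)`, and `(|a_j|)` is convex, then `|b_j| ≤ 2|a_j - a_{j-1}|` for all `j ≥ 1`. -/
theorem convex_sequence_key_estimate (G gd : ℝ → ℝ)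
    (hderiv : ∀ ξ ∈ Iic (0 : ℝ), HasDerivWithinAt G (gd ξ) (Iic 0) ξ)
    (hgdcont : ContinuousOn gd (Iic 0))
    (hconv : StrictConvexOn ℝ (Iic 0) G)
    (hmono : StrictMonoOn G (Iic 0))
    (hd : ∀ ξ < (0 : ℝ), 0 < gd ξ ∧ gd ξ < 1)
    (hd0 : gd 0 = 1)
    (hG0 : G 0 = 0)
    (a : ℕ → ℝ) (hneg : ∀ j, a j ≤ 0)
    (hainv : ∀ j : ℕ, gd (a j) = ((2 : ℝ) ^ j)⁻¹)
    (haconv : ∀ j : ℕ, |a (j + 1)| ≤ (|a j| + |a (j + 2)|) / 2) :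
    ∀ j : ℕ, |G (a (j + 1))| ≤ 2 * |a (j + 1) - a j| := by
  have tangent : ∀ i j, G (a i) + ((2 : ℝ) ^ i)⁻¹ * (a j - a i) ≤ G (a j) := fun i j => by
    have h := hconv.convexOn.tangent_le_of_hasDerivWithinAt (hneg i) (hneg j)
      (hderiv (a i) (hneg i))
    rwa [hainv] at h
  have ha0 : a 0 = 0 := by
    by_contra h
    have h1 := (hd (a 0) (lt_of_le_of_ne (hneg 0) h)).2
    simp [hainv] at h1
  have hstep : ∀ j, a (j + 1) ≤ a j := fun j => by
    have h1 := tangent j (j + 1)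
    have h2 := tangent (j + 1) j
    have hp : 0 < ((2 : ℝ) ^ j)⁻¹ := by positivity
    rw [pow_succ, mul_inv] at h2
    by_contra! h
    nlinarith [mul_pos hp (sub_pos.2 h)]
  have hinc : ∀ j, a j - a (j + 1) ≤ a (j + 1) - a (j + 2) := fun j => by
    have h := haconv j
    rw [abs_of_nonpos (hneg _), abs_of_nonpos (hneg _), abs_of_nonpos (hneg _)] at h
    linarith
  have key : ∀ j, -G (a (j + 1)) ≤ (2 - ((2 : ℝ) ^ j)⁻¹) * (a j - a (j + 1)) := fun j => by
    induction j with
    | zero =>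
      have h := tangent 0 1
      rw [ha0, hG0] at h
      norm_num [ha0] at h ⊢
      linarith
    | succ j ih =>
      have h := tangent (j + 1) (j + 2)
      have hp : ((2 : ℝ) ^ j)⁻¹ ≤ 1 := inv_le_one_of_one_le₀ (one_le_pow₀ one_le_two)
      have hmul := mul_le_mul_of_nonneg_left (hinc j)
        (show 0 ≤ 2 - ((2 : ℝ) ^ j)⁻¹ by linarith)
      rw [pow_succ, mul_inv] at h ⊢
      linarith
  intro j
  have hG : G (a (j + 1)) ≤ 0 :=
    hG0 ▸ hmono.monotoneOn (hneg _) (self_mem_Iic : (0 : ℝ) ∈ Iic 0) (hneg (j + 1))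
  have hp : 0 ≤ ((2 : ℝ) ^ j)⁻¹ := by positivity
  rw [abs_of_nonpos hG, abs_of_nonpos (sub_nonpos.2 (hstep j))]
  linarith [key j, mul_nonneg hp (sub_nonneg.2 (hstep j))]
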